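/- Let G be a finitely generated elementary amenable group that is not virtually nilpotent. Then there exists a characteristic subgroup H of G such that G/H is virtually polycyclic and at least one of the following holds: (1) G/H has exponential growth; (2) H is not finitely generated. -/

import Mathlib

section GrowthDefs

variable {G : Type*} [Group G]

/-- The ball of radius `n` w.r.t. a finite set `X`: all elements of `G` that are products
of at most `n` letters from `X ∪ X⁻¹`. -/
def wordBall (X : Finset G) (n : ℕ) : Set G :=
  {g | ∃ l : List G, l.length ≤ n ∧ (∀ x ∈ l, x ∈ X ∨ x⁻¹ ∈ X) ∧ l.prod = g}

/-- The growth function `γ_G^X(n) = card {g ∈ G : ‖g‖_X ≤ n}`. -/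
noncomputable def growthFn (X : Finset G) (n : ℕ) : ℕ :=
  Nat.card (wordBall X n)

/-- The exponential growth rate `ω(G,X) = lim_{n→∞} γ_G^X(n)^{1/n}`, which by
submultiplicativity of the growth function equals `inf_{n ≥ 1} γ_G^X(n)^{1/n}`. -/
noncomputable def growthRateX (X : Finset G) : ℝ :=
  ⨅ n : ℕ, (growthFn X (n + 1) : ℝ) ^ ((1 : ℝ) / (n + 1))

/-- The minimal exponential growth rate `ω(G) = inf_X ω(G,X)`, the infimum being taken
over all finite generating sets `X` of `G`. -/
noncomputable def minGrowthRate (G : Type*) [Group G] : ℝ :=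
  sInf {r : ℝ | ∃ X : Finset G, Subgroup.closure (X : Set G) = ⊤ ∧ r = growthRateX X}

/-- `G` has exponential growth: `ω(G,X) > 1` for some (equivalently, every) finite
generating set `X`. -/
def HasExponentialGrowth (G : Type*) [Group G] : Prop :=
  ∃ X : Finset G, Subgroup.closure (X : Set G) = ⊤ ∧ 1 < growthRateX X

end GrowthDefs

universe u

/-- The class `EG` of elementary amenable groups: the smallest class of groups containing
all abelian groups and all finite groups and closed under taking subgroups, taking
quotient groups, group extensions and direct limits (directed unions). -/
inductive ElementaryAmenable : (G : Type u) → Group G → Prop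
  | abelian (G : Type u) [inst : Group G] (h : ∀ a b : G, a * b = b * a) :
      ElementaryAmenable G inst
  | finite (G : Type u) [inst : Group G] (h : Finite G) : ElementaryAmenable G inst
  | subgroup {G H : Type u} [instG : Group G] [instH : Group H] (f : H →* G)
      (hf : Function.Injective f) (hG : ElementaryAmenable G instG) :
      ElementaryAmenable H instH
  | quotient {G H : Type u} [instG : Group G] [instH : Group H] (f : G →* H)
      (hf : Function.Surjective f) (hG : ElementaryAmenable G instG) :
      ElementaryAmenable H instH
  | extension {G : Type u} [instG : Group G] (N : Subgroup G) [hN : N.Normal]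
      (h1 : ElementaryAmenable N inferInstance)
      (h2 : ElementaryAmenable (G ⧸ N) inferInstance) :
      ElementaryAmenable G instG
  | directedUnion {G : Type u} [instG : Group G] {ι : Type u} (K : ι → Subgroup G)
      (hdir : Directed (· ≤ ·) K) (htop : ⨆ i, K i = ⊤)
      (h : ∀ i, ElementaryAmenable (K i) inferInstance) :
      ElementaryAmenable G instG

/-- A group `G` is polycyclic if it admits a finite subnormal series
`1 = P_k ⊴ P_{k-1} ⊴ … ⊴ P_0 = G` with all quotients `P_{i-1}/P_i` cyclic: each term
is normal in the next one and the corresponding quotient is generated by the image of a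
single element `g`. -/
def IsPolycyclic (G : Type*) [Group G] : Prop :=
  ∃ (n : ℕ) (P : Fin (n + 1) → Subgroup G),
    P 0 = ⊥ ∧ P (Fin.last n) = ⊤ ∧
    ∀ i : Fin n,
      P i.castSucc ≤ P i.succ ∧
      (∀ x ∈ P i.succ, ∀ h ∈ P i.castSucc, x * h * x⁻¹ ∈ P i.castSucc) ∧
      (∃ g ∈ P i.succ, ∀ x ∈ P i.succ, ∃ k : ℤ, (g ^ k)⁻¹ * x ∈ P i.castSucc)

/-- A group is virtually polycyclic if it has a polycyclic subgroup of finite index. -/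
def IsVirtuallyPolycyclic (G : Type*) [Group G] : Prop :=
  ∃ H : Subgroup G, H.FiniteIndex ∧ IsPolycyclic H

/-- A group is virtually nilpotent if it has a nilpotent subgroup of finite index. -/
def IsVirtuallyNilpotent (G : Type*) [Group G] : Prop :=
  ∃ H : Subgroup G, H.FiniteIndex ∧ Group.IsNilpotent H

section QuasiUnipotent

open Polynomial

/-- An endomorphism is quasi-unipotent if one of its positive powers is unipotent. -/
def IsQuasiUnipotent {R : Type*} [Ring R] (f : R) : Prop :=
  ∃ m k : ℕ, 0 < m ∧ (f ^ m - 1) ^ k = 0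

theorem commute_geom_sum_sub_one {R : Type*} [Ring R] (x : R) (n : ℕ) :
    Commute (∑ i ∈ Finset.range n, x ^ i) (x - 1) := by
  rw [commute_iff_eq, geom_sum_mul, mul_geom_sum]

theorem pow_mul_sub_one_pow_eq {R : Type*} [Ring R] (x : R) (m n k : ℕ) :
    (x ^ (m * n) - 1) ^ k = (∑ i ∈ Finset.range n, (x ^ m) ^ i) ^ k * (x ^ m - 1) ^ k := by
  rw [← (commute_geom_sum_sub_one _ _).mul_pow, geom_sum_mul, pow_mul]

theorem pow_eq_one_of_forall_root_norm_le_one {p : ℤ[X]} (hp : p.Monic)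
    (h : ∀ z ∈ p.aroots ℂ, ‖z‖ ≤ 1) {z : ℂ} (hz₀ : z ≠ 0) (hz : z ∈ p.aroots ℂ) :
    ∃ n, 0 < n ∧ z ^ n = 1 := by
  refine pow_eq_one_of_mahlerMeasure_eq_one ?_ hz₀ hz
  rw [mahlerMeasure_eq_leadingCoeff_mul_prod_roots, (hp.map _).leadingCoeff, norm_one, one_mul]
  refine Multiset.prod_eq_one fun x hx ↦ ?_
  obtain ⟨a, ha, rfl⟩ := Multiset.mem_map.1 hx
  exact max_eq_left (h a ha)

theorem norm_le_one_of_forall_pow_norm_lt_two {z : ℂ} (h : ∀ m : ℕ, 0 < m → ‖z ^ m‖ < 2) :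
    ‖z‖ ≤ 1 := by
  by_contra! hz
  obtain ⟨n, hn⟩ := pow_unbounded_of_one_lt 2 hz
  have hn0 : 0 < n := by
    rcases Nat.eq_zero_or_pos n with rfl | h
    · norm_num at hn
    · exact h
  have := h n hn0
  rw [norm_pow] at this
  exact lt_asymm hn this

theorem Matrix.isQuasiUnipotent_of_pow_roots {n : Type*} [Fintype n] [DecidableEq n]
    (M : Matrix n n ℂ) (h : ∀ z ∈ M.charpoly.roots, ∃ m : ℕ, 0 < m ∧ z ^ m = 1) :
    IsQuasiUnipotent M := by
  classical
  choose! e he0 he1 using h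
  set m := ∏ z ∈ M.charpoly.roots.toFinset, e z with hm
  refine ⟨m, M.charpoly.roots.card, ?_, ?_⟩
  · exact Finset.prod_pos fun z hz ↦ he0 z (Multiset.mem_toFinset.1 hz)
  · have hdvd : M.charpoly ∣ (X ^ m - 1) ^ M.charpoly.roots.card := by
      have h1 := (IsAlgClosed.splits M.charpoly).eq_prod_roots_of_monic (Matrix.charpoly_monic M)
      conv_lhs => rw [h1]
      have h2 : ((X : ℂ[X]) ^ m - 1) ^ M.charpoly.roots.card =
          (M.charpoly.roots.map fun _ ↦ (X : ℂ[X]) ^ m - 1).prod := by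
        rw [Multiset.map_const', Multiset.prod_replicate]
      rw [h2]
      refine Multiset.prod_dvd_prod_of_dvd _ _ fun z hz ↦ ?_
      rw [dvd_iff_isRoot, IsRoot.def]
      obtain ⟨c, hc⟩ := Finset.dvd_prod_of_mem e (Multiset.mem_toFinset.2 hz)
      simp [hm, hc, pow_mul, he1 z hz]
    obtain ⟨q, hq⟩ := hdvd
    have := congrArg (aeval M) hq
    rw [map_mul, Matrix.aeval_self_charpoly, zero_mul] at this
    simpa using this

/-- An integer polynomial with all complex roots in the open disc of radius two. -/
def RootsInDiscTwo (p : ℤ[X]) : Prop := ∀ z : ℂ, 2 ≤ ‖z‖ → aeval z p ≠ 0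

theorem isQuasiUnipotent_of_free {B : Type*} [AddCommGroup B] [Module.Finite ℤ B]
    [Module.Free ℤ B] {f : Module.End ℤ B} (hf : IsUnit f)
    (h : ∀ m : ℕ, 0 < m → ∃ p : ℤ[X], RootsInDiscTwo p ∧ aeval (f ^ m) p = 0) :
    IsQuasiUnipotent f := by
  classical
  set b := Module.Free.chooseBasis ℤ B
  set A := LinearMap.toMatrix b b f with hA
  let Φ : Module.End ℤ B →+* Matrix _ _ ℂ :=
    (Int.castRingHom ℂ).mapMatrix.comp (LinearMap.toMatrixAlgEquiv b).toRingEquiv.toRingHom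
  have hΦ : Function.Injective Φ :=
    (Matrix.map_injective (RingHom.injective_int (Int.castRingHom ℂ))).comp
      (LinearMap.toMatrixAlgEquiv b).injective
  have hchar : (Φ f).charpoly = A.charpoly.map (Int.castRingHom ℂ) :=
    Matrix.charpoly_map A (Int.castRingHom ℂ)
  have hroots : ∀ z ∈ A.charpoly.aroots ℂ, z ∈ spectrum ℂ (Φ f) := by
    intro z hz
    rw [Matrix.mem_spectrum_iff_isRoot_charpoly, hchar]
    exact (mem_roots'.1 hz).2
  have hnorm : ∀ z ∈ A.charpoly.aroots ℂ, ‖z‖ ≤ 1 := by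
    intro z hz
    refine norm_le_one_of_forall_pow_norm_lt_two fun m hm ↦ ?_
    obtain ⟨p, hp, hp0⟩ := h m hm
    by_contra! hge
    refine hp _ hge ?_
    have h1 : aeval (Φ f) ((p.map (Int.castRingHom ℂ)).comp (X ^ m)) = 0 := by
      rw [aeval_comp]
      have := congrArg Φ hp0
      rw [map_zero] at this
      rw [← this, aeval_def (f ^ m), hom_eval₂, map_pow, aeval_def, eval₂_map]
      simp only [map_pow, aeval_X]
      exact eval₂_congr (RingHom.ext_int _ _) rfl rfl
    have h2 := spectrum.subset_polynomial_aeval (Φ f) ((p.map (Int.castRingHom ℂ)).comp (X ^ m))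
      ⟨z, hroots z hz, rfl⟩
    cases isEmpty_or_nonempty (Module.Free.ChooseBasisIndex ℤ B) with
    | inl hE =>
      have := hroots z hz
      rw [spectrum.of_subsingleton] at this
      exact this.elim
    | inr hE =>
      rw [h1, spectrum.zero_eq] at h2
      simpa [aeval_def, eval_map] using h2
  obtain ⟨m, k, hm, hk⟩ := Matrix.isQuasiUnipotent_of_pow_roots (Φ f) (by
    intro z hz
    rw [hchar] at hz
    refine pow_eq_one_of_forall_root_norm_le_one (Matrix.charpoly_monic A) hnorm ?_ hz
    rintro rfl
    exact spectrum.zero_mem_iff ℂ |>.1 (hroots 0 hz) (hf.map Φ))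
  exact ⟨m, k, hm, hΦ (by simpa using hk)⟩

theorem aeval_apply_comm {A B : Type*} [AddCommGroup A] [AddCommGroup B] {f : Module.End ℤ A}
    {g : Module.End ℤ B} {π : A →ₗ[ℤ] B} (h : ∀ a, π (f a) = g (π a)) (p : ℤ[X]) (a : A) :
    π (aeval f p a) = aeval g p (π a) := by
  induction p using Polynomial.induction_on generalizing a with
  | C c => simp
  | add p q hp hq => simp [hp, hq]
  | monomial n c ih =>
    have h1 := ih (f a)
    rw [h] at h1
    simpa [pow_succ, ← mul_assoc] using h1

theorem exists_pow_eq_one_of_finite {T : Type*} [AddCommGroup T] [Finite T]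
    {f : Module.End ℤ T} (hf : Function.Injective f) : ∃ m : ℕ, 0 < m ∧ f ^ m = 1 := by
  have : Finite (Module.End ℤ T) := DFunLike.finite _
  have hu : IsUnit f := (Module.End.isUnit_iff f).2 (Finite.injective_iff_bijective.1 hf)
  obtain ⟨u, rfl⟩ := hu
  obtain ⟨m, hm, h⟩ := (isOfFinOrder_of_finite u).exists_pow_eq_one
  exact ⟨m, hm, by rw [← Units.val_pow_eq_pow_val, h, Units.val_one]⟩

theorem isQuasiUnipotent_of_finite {A : Type*} [AddCommGroup A] [Module.Finite ℤ A]
    {f : Module.End ℤ A} (hf : IsUnit f)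
    (h : ∀ m : ℕ, 0 < m → ∀ a, ∃ p : ℤ[X], RootsInDiscTwo p ∧ aeval (f ^ m) p a = 0) :
    IsQuasiUnipotent f := by
  have hT (g : Module.End ℤ A) (a : A) (ha : a ∈ Submodule.torsion ℤ A) :
      g a ∈ Submodule.torsion ℤ A := by
    obtain ⟨c, hc⟩ := ha
    exact ⟨c, (map_zsmul g c.1 a).symm.trans ((congrArg g hc).trans (map_zero g))⟩
  set T := Submodule.torsion ℤ A with hTdef
  obtain ⟨⟨u, v, huv, hvu⟩, rfl⟩ := hf
  change IsQuasiUnipotent u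
  change ∀ m : ℕ, 0 < m → ∀ a, ∃ p : ℤ[X], RootsInDiscTwo p ∧ aeval (u ^ m) p a = 0 at h
  have hinj : Function.Injective u :=
    Function.LeftInverse.injective (g := v) fun a ↦ congrArg (fun w : Module.End ℤ A ↦ w a) hvu
  have : Finite T := Module.finite_of_fg_torsion T (Submodule.torsion_isTorsion)
  obtain ⟨e, he, heT⟩ := exists_pow_eq_one_of_finite (f := u.restrict (hT u))
    (fun x y hxy ↦ Subtype.ext (hinj (congrArg Subtype.val hxy)))
  have heT' : ∀ a ∈ T, (u ^ e) a = a := by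
    intro a ha
    have := congrArg (fun w : Module.End ℤ T ↦ (w ⟨a, ha⟩ : A)) heT
    rwa [Module.End.pow_restrict] at this
  let q (g : Module.End ℤ A) : Module.End ℤ (A ⧸ T) := T.mapQ T g (hT g)
  have hq (g : Module.End ℤ A) (a : A) : T.mkQ (g a) = q g (T.mkQ a) := rfl
  have hqpow (g : Module.End ℤ A) (n : ℕ) : q (g ^ n) = q g ^ n := by
    ext a
    have := aeval_apply_comm (hq g) (X ^ n) a
    simp only [map_pow, aeval_X] at this
    exact this
  have hqu : IsUnit (q u) := by
    refine ⟨⟨q u, q v, ?_, ?_⟩, rfl⟩ <;> ext a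
    · exact congrArg (fun w : Module.End ℤ A ↦ T.mkQ (w a)) huv
    · exact congrArg (fun w : Module.End ℤ A ↦ T.mkQ (w a)) hvu
  obtain ⟨m, k, hm, hk⟩ := isQuasiUnipotent_of_free hqu (by
    intro m hm
    choose p hp hpa using h m hm
    obtain ⟨S, hS⟩ := (Module.Finite.fg_top : (⊤ : Submodule ℤ A).FG)
    refine ⟨∏ s ∈ S, p s, ?_, ?_⟩
    · intro z hz
      rw [map_prod]
      exact Finset.prod_ne_zero_iff.2 fun s _ ↦ hp s z hz
    · have hz : aeval (u ^ m) (∏ s ∈ S, p s) = 0 := by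
        refine LinearMap.ext_on hS ?_
        intro s hs
        obtain ⟨c, hc⟩ := Finset.dvd_prod_of_mem p hs
        rw [hc, mul_comm, map_mul]
        simp [hpa]
      ext a
      have := aeval_apply_comm (hq (u ^ m)) (∏ s ∈ S, p s) a
      rw [hz, hqpow] at this
      simpa using this.symm)
  refine ⟨m * e, k + 1, Nat.mul_pos hm he, ?_⟩
  ext a
  have hw : ((u ^ m - 1) ^ k) a ∈ T := by
    have := aeval_apply_comm (hq u) ((X ^ m - 1) ^ k) a
    simp only [map_pow, map_sub, aeval_X, map_one, hk, LinearMap.zero_apply] at this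
    exact (Submodule.Quotient.mk_eq_zero T).1 this
  rw [pow_succ', pow_mul_sub_one_pow_eq]
  set w := ((∑ i ∈ Finset.range e, (u ^ m) ^ i) ^ k) (((u ^ m - 1) ^ k) a) with hw_def
  have h1 : (u ^ (m * e)) w = w := by
    rw [mul_comm, pow_mul, Module.End.pow_apply]
    exact Function.iterate_fixed (heT' _ (hT _ _ hw)) m
  simp [Module.End.mul_apply, ← hw_def, h1]

end QuasiUnipotent

section WordCollisions

open Polynomial

/-- Any two elements `u, v` have two distinct positive words of the same length with equal values. -/
def HasWordCollisions (G : Type*) [Group G] : Prop :=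
  ∀ u v : G, ∃ l l' : List Bool, l ≠ l' ∧ l.length = l'.length ∧
    (l.map fun b ↦ cond b v u).prod = (l'.map fun b ↦ cond b v u).prod

theorem HasWordCollisions.of_injective {G H : Type*} [Group G] [Group H]
    (h : HasWordCollisions G) {f : H →* G} (hf : Function.Injective f) : HasWordCollisions H := by
  intro u v
  obtain ⟨l, l', hne, hlen, hprod⟩ := h (f u) (f v)
  refine ⟨l, l', hne, hlen, hf ?_⟩
  simpa [map_list_prod, List.map_map, Function.comp_def, Bool.apply_cond] using hprod

theorem HasWordCollisions.of_surjective {G H : Type*} [Group G] [Group H]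
    (h : HasWordCollisions G) {f : G →* H} (hf : Function.Surjective f) : HasWordCollisions H := by
  intro u v
  obtain ⟨u, rfl⟩ := hf u
  obtain ⟨v, rfl⟩ := hf v
  obtain ⟨l, l', hne, hlen, hprod⟩ := h u v
  refine ⟨l, l', hne, hlen, ?_⟩
  simpa [map_list_prod, List.map_map, Function.comp_def, Bool.apply_cond] using congrArg f hprod

/-- The polynomial with coefficients in `{0, 1}` given by a list of bits. -/
noncomputable def bitPolynomial : List Bool → ℤ[X]
  | [] => 0
  | b :: l => C (cond b 1 0) + X * bitPolynomial l

theorem one_le_norm_aeval_bitPolynomial_sub {z : ℂ} (hz : 2 ≤ ‖z‖) :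
    ∀ {l l' : List Bool}, l.length = l'.length → l ≠ l' →
      1 ≤ ‖aeval z (bitPolynomial l) - aeval z (bitPolynomial l')‖
  | [], [], _, h => (h rfl).elim
  | b :: l, b' :: l', hlen, hne => by
    have hlen' : l.length = l'.length := by simpa using hlen
    by_cases hl : l = l'
    · subst hl
      cases b <;> cases b' <;> simp_all [bitPolynomial]
    · have ih := one_le_norm_aeval_bitPolynomial_sub hz hlen' hl
      set d := aeval z (bitPolynomial l) - aeval z (bitPolynomial l') with hd
      have hzd : 2 ≤ ‖z * d‖ := by
        rw [norm_mul]
        nlinarith [norm_nonneg z]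
      have hb : ‖((cond b' 1 0 : ℤ) : ℂ) - ((cond b 1 0 : ℤ) : ℂ)‖ ≤ 1 := by
        cases b <;> cases b' <;> simp
      have heq : aeval z (bitPolynomial (b :: l)) - aeval z (bitPolynomial (b' :: l')) =
          z * d - (((cond b' 1 0 : ℤ) : ℂ) - ((cond b 1 0 : ℤ) : ℂ)) := by
        simp only [bitPolynomial, map_add, map_mul, aeval_X, aeval_C, hd,
          algebraMap_int_eq, Int.coe_castRingHom]
        ring
      rw [heq]
      have := norm_sub_norm_le (z * d) (((cond b' 1 0 : ℤ) : ℂ) - ((cond b 1 0 : ℤ) : ℂ))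
      linarith

theorem prod_bits_eq {G V : Type*} [Group G] [AddCommGroup V] (i : Multiplicative V →* G)
    {f : Module.End ℤ V} {s : G}
    (hs : ∀ v, s * i (.ofAdd v) = i (.ofAdd (f v)) * s) (a : V) (l : List Bool) :
    (l.map fun b ↦ cond b (i (.ofAdd a) * s) s).prod =
      i (.ofAdd (aeval f (bitPolynomial l) a)) * s ^ l.length := by
  induction l with
  | nil => simp [bitPolynomial]
  | cons b l ih =>
    rw [List.map_cons, List.prod_cons, ih, List.length_cons, pow_succ']
    cases b
    · simp [bitPolynomial, ← mul_assoc, hs]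
    · simp only [cond_true, bitPolynomial, map_add, map_mul, aeval_X, map_one,
        LinearMap.add_apply, Module.End.one_apply, Module.End.mul_apply, ofAdd_add]
      rw [mul_assoc, ← mul_assoc s, hs]
      simp only [mul_assoc]

theorem HasWordCollisions.isQuasiUnipotent {G V : Type*} [Group G] [AddCommGroup V]
    [Module.Finite ℤ V] (hG : HasWordCollisions G) {i : Multiplicative V →* G}
    (hi : Function.Injective i) {f : Module.End ℤ V} (hf : IsUnit f) {t : G}
    (ht : ∀ v, t * i (.ofAdd v) = i (.ofAdd (f v)) * t) : IsQuasiUnipotent f := by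
  refine isQuasiUnipotent_of_finite hf fun m hm a ↦ ?_
  clear hm
  have hs : ∀ v, t ^ m * i (.ofAdd v) = i (.ofAdd ((f ^ m) v)) * t ^ m := by
    induction m with
    | zero => simp
    | succ m ih =>
      intro v
      rw [pow_succ, mul_assoc, ht, ← mul_assoc, ih, mul_assoc, pow_succ]
      rfl
  obtain ⟨l, l', hne, hlen, hprod⟩ := hG (t ^ m) (i (.ofAdd a) * t ^ m)
  rw [prod_bits_eq i hs, prod_bits_eq i hs, hlen, mul_left_inj] at hprod
  refine ⟨bitPolynomial l - bitPolynomial l', fun z hz h0 ↦ ?_, ?_⟩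
  · have := one_le_norm_aeval_bitPolynomial_sub hz hlen hne
    rw [← map_sub, h0, norm_zero] at this
    linarith
  · rw [map_sub, LinearMap.sub_apply, sub_eq_zero]
    exact Multiplicative.ofAdd.injective (hi hprod)

end WordCollisions

section NilpotentExtension

open Subgroup
open scoped IsMulCommutative

/-- The conjugation action of a group on an abelian normal subgroup, written additively. -/
def conjEnd {G : Type*} [Group G] (A : Subgroup G) [A.Normal] [IsMulCommutative A] :
    G →* Module.End ℤ (Additive A) where
  toFun g := (MulAut.conjNormal g : MulAut A).toMonoidHom.toAdditive.toIntLinearMap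
  map_one' := by ext; simp
  map_mul' g h := by ext; simp [mul_assoc]

theorem conjEnd_apply {G : Type*} [Group G] (A : Subgroup G) [A.Normal] [IsMulCommutative A]
    (g : G) (a : Additive A) : ((conjEnd A g a).toMul : G) = g * a.toMul * g⁻¹ := by
  simp [conjEnd]

theorem mem_iterate_commutator {G : Type*} [Group G] {A K : Subgroup G} [A.Normal]
    [IsMulCommutative A] {σ : Module.End ℤ (Additive A)}
    (hK : ∀ g ∈ K, ∃ c, Commute c (σ - 1) ∧ conjEnd A g = 1 + (σ - 1) * c) (k : ℕ) {x : G}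
    (hx : x ∈ (fun X ↦ ⁅X, K⁆)^[k] A) :
    ∃ a : Additive A, ((((σ - 1) ^ k) a).toMul : G) = x := by
  induction k generalizing x with
  | zero => exact ⟨.ofMul ⟨x, hx⟩, rfl⟩
  | succ k ih =>
    let F : Additive A →+ Additive A := ((σ - 1) ^ (k + 1)).toAddMonoidHom
    let R : Subgroup G := (A.subtype.comp (MonoidHom.toAdditive.symm F)).range
    suffices h : (fun X ↦ ⁅X, K⁆)^[k + 1] A ≤ R by
      obtain ⟨a, ha⟩ := h hx
      exact ⟨.ofMul a, ha⟩
    rw [Function.iterate_succ_apply']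
    refine commutator_le.2 fun y hy g hg ↦ ?_
    obtain ⟨a, rfl⟩ := ih hy
    obtain ⟨c, hc, hgc⟩ := hK g hg
    refine ⟨(-(c a)).toMul, ?_⟩
    have h1 : ((σ - 1) ^ (k + 1)) (-(c a)) = ((σ - 1) ^ k) a - conjEnd A g (((σ - 1) ^ k) a) := by
      have h2 : (σ - 1) ^ (k + 1) * c = (σ - 1) * c * (σ - 1) ^ k := by
        rw [pow_succ', mul_assoc, mul_assoc, (hc.pow_right k).eq]
      have h3 := congrArg (fun w : Module.End ℤ (Additive A) ↦ w a) h2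
      simp only [Module.End.mul_apply] at h3
      rw [map_neg, h3, hgc]
      simp
    change ((((σ - 1) ^ (k + 1)) (-(c a))).toMul : G) = _
    rw [h1, toMul_sub, Subgroup.coe_div, conjEnd_apply, commutatorElement_def]
    simp only [div_eq_mul_inv, mul_inv_rev, inv_inv, mul_assoc]

theorem exists_iterate_commutator_eq_bot_of_central {G : Type*} [Group G]
    (hG : HasWordCollisions G) {A N : Subgroup G} [A.Normal] (hAN : A ≤ N)
    (hcomm : ⁅A, N⁆ = ⊥) (hfg : A.FG) (t : G) :
    ∃ m k : ℕ, 0 < m ∧ ∀ m', m ∣ m' →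
      (fun X ↦ ⁅X, N ⊔ zpowers (t ^ m')⁆)^[k] A = ⊥ := by
  have hA : IsMulCommutative A :=
    commutator_self_eq_bot_iff.1 (le_bot_iff.1 (hcomm ▸ commutator_mono le_rfl hAN))
  have : Group.FG A := (Group.fg_iff_subgroup_fg A).2 hfg
  have : Module.Finite ℤ (Additive A) := Module.Finite.iff_addGroup_fg.2 inferInstance
  obtain ⟨m, k, hm, hk⟩ := hG.isQuasiUnipotent (V := Additive A)
    (i := A.subtype.comp (MulEquiv.toMonoidHom (MulEquiv.multiplicativeAdditive A)))
    (A.subtype_injective.comp (MulEquiv.multiplicativeAdditive A).injective)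
    ((Group.isUnit t).map (conjEnd A))
    (t := t) (fun v ↦ by
      change t * (v.toMul : G) = ((conjEnd A t v).toMul : G) * t
      simp [conjEnd_apply])
  refine ⟨m, k, hm, ?_⟩
  rintro _ ⟨n, rfl⟩
  have hk' : (conjEnd A (t ^ (m * n)) - 1) ^ k = 0 := by
    rw [map_pow, pow_mul_sub_one_pow_eq, hk, mul_zero]
  set σ := conjEnd A (t ^ (m * n)) with hσ
  let S : Subgroup G :=
    { carrier := {g | ∃ c, Commute c (σ - 1) ∧ conjEnd A g = 1 + (σ - 1) * c}
      one_mem' := ⟨0, Commute.zero_left _, by simp⟩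
      mul_mem' := by
        rintro g h ⟨c, hc, hg⟩ ⟨d, hd, hh⟩
        refine ⟨c + d + c * (σ - 1) * d, ?_, ?_⟩
        · exact (hc.add_left hd).add_left ((hc.mul_left (Commute.refl _)).mul_left hd)
        · rw [map_mul, hg, hh]
          noncomm_ring
      inv_mem' := by
        rintro g ⟨c, hc, hg⟩
        have h1 : conjEnd A g * conjEnd A g⁻¹ = 1 := by rw [← map_mul]; simp
        have h2 : conjEnd A g⁻¹ * conjEnd A g = 1 := by rw [← map_mul]; simp
        have hgc : Commute (conjEnd A g) (σ - 1) := by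
          rw [hg]
          exact (Commute.one_left _).add_left ((Commute.refl _).mul_left hc)
        have hgc' : Commute (conjEnd A g⁻¹) (σ - 1) :=
          Commute.units_inv_left (u := ⟨_, _, h1, h2⟩) hgc
        refine ⟨-(c * conjEnd A g⁻¹), (hc.mul_left hgc').neg_left, ?_⟩
        have h3 : (σ - 1) * c = conjEnd A g - 1 := by rw [hg]; abel
        rw [mul_neg, ← mul_assoc, h3, sub_mul, h1]
        abel }
  have hS : N ⊔ zpowers (t ^ (m * n)) ≤ S := by
    refine sup_le (fun x hx ↦ ⟨0, Commute.zero_left _, ?_⟩)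
      (zpowers_le.2 ⟨1, Commute.one_left _, ?_⟩)
    · ext a
      have : Commute (a.toMul : G) x := commutatorElement_eq_one_iff_commute.1
        (mem_bot.1 (hcomm ▸ commutator_mem_commutator a.toMul.2 hx))
      have h1 := conjEnd_apply A x a
      rw [← this.eq, mul_inv_cancel_right] at h1
      simpa using h1
    · simp [hσ]
  refine (eq_bot_iff_forall _).2 fun x hx ↦ ?_
  obtain ⟨a, rfl⟩ := mem_iterate_commutator (fun g hg ↦ hS hg) k hx
  simp [hk']

theorem iterate_commutator_mono {G : Type*} [Group G] {A B K : Subgroup G} (h : A ≤ B) (k : ℕ) :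
    (fun X ↦ ⁅X, K⁆)^[k] A ≤ (fun X ↦ ⁅X, K⁆)^[k] B :=
  Monotone.iterate (fun _ _ h ↦ commutator_mono h le_rfl) k h

theorem map_iterate_commutator {G H : Type*} [Group G] [Group H] (f : G →* H) (A K : Subgroup G)
    (k : ℕ) : ((fun X ↦ ⁅X, K⁆)^[k] A).map f = (fun X ↦ ⁅X, K.map f⁆)^[k] (A.map f) := by
  induction k with
  | zero => rfl
  | succ k ih => rw [Function.iterate_succ_apply', Function.iterate_succ_apply', map_commutator, ih]

theorem exists_iterate_commutator_eq_bot {G : Type*} [Group G] (hG : HasWordCollisions G)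
    {N : Subgroup G} [N.Normal] (hN : ∀ A ≤ N, A.FG) (t : G) (c : ℕ) :
    ∀ A : Subgroup G, A.Normal → A ≤ N → (fun X ↦ ⁅X, N⁆)^[c] A = ⊥ →
      ∃ m k : ℕ, 0 < m ∧ ∀ m', m ∣ m' →
        (fun X ↦ ⁅X, N ⊔ zpowers (t ^ m')⁆)^[k] A = ⊥ := by
  induction c with
  | zero =>
    intro A _ _ h
    exact ⟨1, 0, one_pos, fun _ _ ↦ h⟩
  | succ c ih =>
    intro A hA hAN h
    obtain ⟨m₁, k₁, hm₁, h₁⟩ := ih ⁅A, N⁆ inferInstance (commutator_le_right _ _) h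
    let π := QuotientGroup.mk' ⁅A, N⁆
    have hπ : Function.Surjective π := QuotientGroup.mk'_surjective _
    have : (A.map π).Normal := hA.map π hπ
    obtain ⟨m₂, k₂, hm₂, h₂⟩ := exists_iterate_commutator_eq_bot_of_central
      (hG.of_surjective hπ) (map_mono hAN : A.map π ≤ N.map π)
      (by rw [← map_commutator, Subgroup.map_eq_bot_iff, QuotientGroup.ker_mk'])
      ((fg_iff_submonoid_fg _).2 (((fg_iff_submonoid_fg _).1 (hN A hAN)).map π)) (π t)
    refine ⟨m₁ * m₂, k₁ + k₂, Nat.mul_pos hm₁ hm₂, fun m' hm' ↦ ?_⟩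
    rw [Function.iterate_add_apply, eq_bot_iff, ← h₁ m' (dvd_of_mul_right_dvd hm')]
    refine iterate_commutator_mono ?_ k₁
    have h3 := h₂ m' (dvd_of_mul_left_dvd hm')
    rwa [← map_pow, ← MonoidHom.map_zpowers, ← Subgroup.map_sup, ← map_iterate_commutator,
      Subgroup.map_eq_bot_iff, QuotientGroup.ker_mk'] at h3

theorem commutator_sup_zpowers_le {G : Type*} [Group G] (N : Subgroup G) [N.Normal] (t : G) :
    ⁅N ⊔ zpowers t, N ⊔ zpowers t⁆ ≤ N := by
  let π := QuotientGroup.mk' N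
  have h : (⁅N ⊔ zpowers t, N ⊔ zpowers t⁆).map π = ⊥ := by
    rw [map_commutator, Subgroup.map_sup, (Subgroup.map_eq_bot_iff N).2 (QuotientGroup.ker_mk' N).ge,
      bot_sup_eq, MonoidHom.map_zpowers, commutator_self_eq_bot_iff]
    infer_instance
  rwa [Subgroup.map_eq_bot_iff, QuotientGroup.ker_mk'] at h

theorem exists_isNilpotent_sup_zpowers {G : Type*} [Group G] (hG : HasWordCollisions G)
    {N : Subgroup G} [N.Normal] (hN : ∀ A ≤ N, A.FG) (hnil : Group.IsNilpotent N) (t : G) :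
    ∃ m : ℕ, 0 < m ∧ Group.IsNilpotent ↥(N ⊔ zpowers (t ^ m)) := by
  have hlcs (S : Subgroup G) (n : ℕ) :
      S.lowerCentralSeries n = (fun X ↦ ⁅X, S⁆)^[n] S := by
    induction n with
    | zero => rfl
    | succ n ih => rw [Subgroup.lowerCentralSeries_succ, ih, Function.iterate_succ_apply']
  obtain ⟨c, hc⟩ := (isNilpotent_iff_lowerCentralSeries N).1 hnil
  obtain ⟨m, k, hm, hk⟩ := exists_iterate_commutator_eq_bot hG hN t c N inferInstance le_rfl
    (hlcs N c ▸ hc)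
  refine ⟨m, hm, (isNilpotent_iff_lowerCentralSeries _).2 ⟨k + 1, ?_⟩⟩
  rw [hlcs, Function.iterate_succ_apply, eq_bot_iff, ← hk m dvd_rfl]
  exact iterate_commutator_mono (commutator_sup_zpowers_le N _) k

end NilpotentExtension

section IteratedExtensions

/-- Groups with a finite subnormal series in which every quotient embeds into a group of the
class `C`. -/
inductive IsIteratedExtension (C : (Q : Type u) → Group Q → Prop) : (G : Type u) → Group G → Prop
  | trivial (G : Type u) [inst : Group G] [Subsingleton G] : IsIteratedExtension C G inst
  | ext {G Q : Type u} [instG : Group G] [instQ : Group Q] (f : G →* Q) (hQ : C Q instQ)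
      (hker : IsIteratedExtension C f.ker inferInstance) : IsIteratedExtension C G instG

variable {C : (Q : Type u) → Group Q → Prop}

theorem IsIteratedExtension.of_injective {G : Type u} {instG : Group G}
    (h : IsIteratedExtension C G instG) : ∀ {H : Type u} [instH : Group H] (i : H →* G),
      Function.Injective i → IsIteratedExtension C H instH := by
  induction h with
  | trivial G =>
    intro H _ i hi
    have := hi.subsingleton
    exact .trivial H
  | ext f hQ hker ih =>
    intro H _ i hi
    exact .ext (f.comp i) hQ (ih (i.subgroupComap f.ker)
      fun x y hxy ↦ Subtype.ext (hi (congrArg Subtype.val hxy)))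

theorem IsIteratedExtension.of_ker {Q : Type u} {instQ : Group Q} (h : IsIteratedExtension C Q instQ) :
    ∀ {G : Type u} [instG : Group G] (f : G →* Q), IsIteratedExtension C f.ker inferInstance →
      IsIteratedExtension C G instG := by
  induction h with
  | trivial Q =>
    intro G _ f hf
    exact hf.of_injective ((MonoidHom.id G).codRestrict f.ker fun _ ↦ Subsingleton.elim _ _)
      fun x y hxy ↦ congrArg Subtype.val hxy
  | ext g hR hker ih =>
    intro G _ f hf
    refine .ext (g.comp f) hR (ih (f.subgroupComap g.ker) (hf.of_injective
      (((Subgroup.subtype _).comp (Subgroup.subtype _)).codRestrict f.ker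
        fun x ↦ congrArg Subtype.val x.2) fun x y hxy ↦ ?_))
    have h := congrArg Subtype.val hxy
    exact Subtype.ext (Subtype.ext h)

/-- Iterated extensions of groups that are cyclic. -/
abbrev IsPolyCyclic (G : Type u) [inst : Group G] : Prop :=
  IsIteratedExtension (fun Q _ ↦ IsCyclic Q) G inst

/-- Iterated extensions of groups that are cyclic or finite. -/
abbrev IsPolyCyclicOrFinite (G : Type u) [inst : Group G] : Prop :=
  IsIteratedExtension (fun Q _ ↦ IsCyclic Q ∨ Finite Q) G inst

theorem IsPolyCyclicOrFinite.of_finite (G : Type u) [Group G] [Finite G] :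
    IsPolyCyclicOrFinite G :=
  have : Subsingleton (MonoidHom.id G).ker := ⟨fun x y ↦ Subtype.ext (x.2.trans y.2.symm)⟩
  .ext (MonoidHom.id G) (.inr inferInstance) (.trivial _)

theorem MonoidHom.exists_zpow_inv_mul_mem_ker {G Q : Type*} [Group G] [Group Q] [IsCyclic Q]
    (f : G →* Q) : ∃ t : G, ∀ x, ∃ k : ℤ, (t ^ k)⁻¹ * x ∈ f.ker := by
  obtain ⟨⟨_, t, rfl⟩, ht⟩ := IsCyclic.exists_generator (α := f.range)
  refine ⟨t, fun x ↦ ?_⟩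
  obtain ⟨k, hk⟩ := ht ⟨f x, x, rfl⟩
  refine ⟨k, ?_⟩
  have : f t ^ k = f x := congrArg Subtype.val hk
  rw [MonoidHom.mem_ker, map_mul, map_inv, map_zpow, this, inv_mul_cancel]

theorem Group.FG.of_ker_of_range {G Q : Type*} [Group G] [Group Q] (f : G →* Q)
    (hker : Group.FG f.ker) (hrange : Group.FG f.range) : Group.FG G := by
  classical
  obtain ⟨T, hT⟩ := (Group.fg_iff_subgroup_fg _).1 hrange
  have hmap : (Subgroup.closure (T.image (Function.invFun f) : Set G)).map f = f.range := by
    rw [MonoidHom.map_closure, ← hT, Finset.coe_image, Set.image_image]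
    congr 1
    refine (Set.image_congr fun x hx ↦ ?_).trans (Set.image_id _)
    have : x ∈ f.range := hT ▸ Subgroup.subset_closure hx
    exact Function.invFun_eq this
  refine ⟨?_⟩
  have hsup : f.ker ⊔ Subgroup.closure (T.image (Function.invFun f) : Set G) = ⊤ := by
    refine Subgroup.map_injective_of_ker_le f le_sup_left le_top ?_
    rw [Subgroup.map_sup, hmap, ← MonoidHom.range_eq_map, sup_eq_right]
    exact Subgroup.map_le_range f _
  exact hsup ▸ ((Group.fg_iff_subgroup_fg _).1 hker).sup ⟨_, rfl⟩

theorem IsPolyCyclicOrFinite.fg {G : Type u} [instG : Group G] (h : IsPolyCyclicOrFinite G) :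
    Group.FG G := by
  induction h with
  | trivial G => infer_instance
  | ext f hQ hker ih =>
    refine .of_ker_of_range f ih ?_
    rcases hQ with hQ | hQ
    · obtain ⟨g, hg⟩ := IsCyclic.exists_generator (α := f.range)
      refine ⟨{g}, ?_⟩
      rwa [Finset.coe_singleton, ← Subgroup.zpowers_eq_closure, Subgroup.eq_top_iff']
    · infer_instance

theorem IsPolyCyclicOrFinite.subgroup_fg {G : Type u} [Group G] (h : IsPolyCyclicOrFinite G)
    (A : Subgroup G) : A.FG :=
  (Group.fg_iff_subgroup_fg A).1 (fg (h.of_injective A.subtype A.subtype_injective))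

theorem IsPolyCyclicOrFinite.of_comm {G : Type u} [Group G] [hG : Group.FG G]
    (hcomm : ∀ a b : G, a * b = b * a) : IsPolyCyclicOrFinite G := by
  classical
  obtain ⟨S, hS⟩ := hG
  suffices h : ∀ S : Finset G, IsPolyCyclicOrFinite (Subgroup.closure (S : Set G)) from
    (h S).of_injective ((MonoidHom.id G).codRestrict _ fun x ↦ hS ▸ Subgroup.mem_top x)
      fun x y hxy ↦ congrArg Subtype.val hxy
  clear S hS
  intro S
  induction S using Finset.induction_on with
  | empty =>
    rw [Finset.coe_empty, Subgroup.closure_empty]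
    exact .trivial _
  | insert a S _ ih =>
    have : (Subgroup.closure (S : Set G)).Normal :=
      ⟨fun x hx g ↦ by rwa [hcomm g x, mul_inv_cancel_right]⟩
    let π := QuotientGroup.mk' (Subgroup.closure (S : Set G))
    have hle : (Subgroup.closure (insert a S : Set G)).map π ≤ Subgroup.zpowers (π a) := by
      rw [Set.insert_eq, Subgroup.closure_union, Subgroup.map_sup,
        (Subgroup.map_eq_bot_iff _).2 (QuotientGroup.ker_mk' _).ge, sup_bot_eq,
        ← Subgroup.zpowers_eq_closure, MonoidHom.map_zpowers]
    rw [Finset.coe_insert]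
    refine .ext (Q := Subgroup.zpowers (π a)) ((π.comp (Subgroup.subtype _)).codRestrict _
      fun x ↦ hle ⟨x, x.2, rfl⟩) (.inl inferInstance) (ih.of_injective
        (((Subgroup.subtype _).comp (Subgroup.subtype _)).codRestrict _ fun x ↦
          (QuotientGroup.eq_one_iff _).1 (congrArg Subtype.val x.2)) fun x y hxy ↦ ?_)
    have h := congrArg Subtype.val hxy
    exact Subtype.ext (Subtype.ext h)

theorem IsPolyCyclic.isPolycyclic {G : Type u} [instG : Group G] (h : IsPolyCyclic G) :
    IsPolycyclic G := by
  induction h with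
  | trivial G => exact ⟨0, fun _ ↦ ⊥, rfl, Subsingleton.elim _ _, fun i ↦ i.elim0⟩
  | ext f hQ hker ih =>
    obtain ⟨n, P, h0, hlast, hP⟩ := ih
    refine ⟨n + 1, Fin.snoc (fun i ↦ (P i).map f.ker.subtype) ⊤, ?_, Fin.snoc_last _ _, ?_⟩
    · rw [← Fin.castSucc_zero, Fin.snoc_castSucc, h0, Subgroup.map_bot]
    · intro i
      induction i using Fin.lastCases with
      | last =>
        have : (P (Fin.last n)).map f.ker.subtype = f.ker := by
          rw [hlast, ← MonoidHom.range_eq_map, Subgroup.range_subtype]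
        rw [Fin.succ_last, Fin.snoc_last, Fin.snoc_castSucc, this]
        obtain ⟨t, ht⟩ := f.exists_zpow_inv_mul_mem_ker
        exact ⟨le_top, fun x _ h hh ↦ f.normal_ker.conj_mem h hh x, t, trivial, fun x _ ↦ ht x⟩
      | cast j =>
        rw [Fin.succ_castSucc, Fin.snoc_castSucc, Fin.snoc_castSucc]
        obtain ⟨hle, hconj, g, hg, hgen⟩ := hP j
        refine ⟨Subgroup.map_mono hle, ?_, g, ⟨g, hg, rfl⟩, ?_⟩
        · rintro _ ⟨x, hx, rfl⟩ _ ⟨h, hh, rfl⟩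
          exact ⟨_, hconj x hx h hh, rfl⟩
        · rintro _ ⟨x, hx, rfl⟩
          obtain ⟨k, hk⟩ := hgen x hx
          exact ⟨k, _, hk, rfl⟩

end IteratedExtensions

section VirtualProperties

theorem MonoidHom.finite_of_fg (G Q : Type*) [Group G] [Group Q] [hG : Group.FG G] [Finite Q] :
    Finite (G →* Q) := by
  obtain ⟨S, hS⟩ := hG
  exact Finite.of_injective (fun (φ : G →* Q) (s : S) ↦ φ s) fun φ ψ h ↦
    MonoidHom.eq_of_eqOn_dense hS fun s hs ↦ congrFun h ⟨s, hs⟩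

theorem Subgroup.exists_characteristic_finiteIndex_le {G : Type*} [Group G] [Group.FG G]
    (K : Subgroup G) [K.FiniteIndex] :
    ∃ M : Subgroup G, M.Characteristic ∧ M.FiniteIndex ∧ M ≤ K := by
  have := MonoidHom.finite_of_fg G (G ⧸ K.normalCore)
  refine ⟨⨅ φ : G →* G ⧸ K.normalCore, φ.ker, ?_, finiteIndex_iInf fun φ ↦ inferInstance,
    (iInf_le _ (QuotientGroup.mk' _)).trans ((QuotientGroup.ker_mk' _).trans_le K.normalCore_le)⟩
  refine characteristic_iff_le_comap.2 fun σ x hx ↦ ?_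
  rw [mem_comap, mem_iInf]
  exact fun φ ↦ mem_iInf.1 hx (φ.comp σ.toMonoidHom)

theorem Subgroup.finiteIndex_sup_zpowers {G Q : Type*} [Group G] [Group Q] (f : G →* Q) {t : G}
    (ht : ∀ x, ∃ k : ℤ, (t ^ k)⁻¹ * x ∈ f.ker) (N : Subgroup f.ker) [N.FiniteIndex]
    [(N.map f.ker.subtype).Normal] {m : ℕ} (hm : 0 < m) :
    (N.map f.ker.subtype ⊔ zpowers (t ^ m)).FiniteIndex := by
  set K := N.map f.ker.subtype ⊔ zpowers (t ^ m)
  suffices Finite (G ⧸ K) from finiteIndex_of_finite_quotient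
  refine Finite.of_surjective
    (fun p : (f.ker ⧸ N) × Fin m ↦ ((((p.1.out : f.ker) : G) * t ^ (p.2 : ℕ) : G) : G ⧸ K)) ?_
  intro y
  obtain ⟨x, rfl⟩ := QuotientGroup.mk_surjective y
  obtain ⟨k, hk⟩ := ht x
  have hc : x * (t ^ k)⁻¹ ∈ f.ker := f.normal_ker.mem_comm hk
  obtain ⟨n, hn⟩ := QuotientGroup.mk_out_eq_mul N ⟨_, hc⟩
  have hm' : (0 : ℤ) < m := by exact_mod_cast hm
  obtain ⟨r, hr⟩ := Int.eq_ofNat_of_zero_le (k.emod_nonneg hm'.ne')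
  have hrm : r < m := by exact_mod_cast hr ▸ k.emod_lt_of_pos hm'
  refine ⟨(((⟨_, hc⟩ : f.ker) : f.ker ⧸ N), ⟨r, hrm⟩), QuotientGroup.eq.2 ?_⟩
  have hk' : t ^ k = t ^ r * (t ^ m) ^ (k / m) := by
    rw [← zpow_natCast, ← zpow_natCast, ← zpow_mul, ← zpow_add]
    congr 1
    have := Int.emod_add_mul_ediv k m
    omega
  have heq : (((⟨_, hc⟩ : f.ker) : f.ker ⧸ N).out * t ^ r : G)⁻¹ * x =
      ((t ^ r)⁻¹ * (n : f.ker)⁻¹ * ((t ^ r)⁻¹)⁻¹) * (t ^ m) ^ (k / m) := by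
    rw [hn]
    have : x = x * (t ^ k)⁻¹ * (t ^ r * (t ^ m) ^ (k / m)) := by rw [← hk', inv_mul_cancel_right]
    nth_rw 2 [this]
    simp only [Subgroup.coe_mul, mul_inv_rev, inv_inv, mul_assoc, mul_inv_cancel_left,
      inv_mul_cancel_left, InvMemClass.coe_inv]
  rw [heq]
  refine mul_mem (mem_sup_left ?_) (mem_sup_right (zpow_mem (mem_zpowers _) _))
  have hnN : ((n : f.ker) : G) ∈ N.map f.ker.subtype := ⟨n, n.2, rfl⟩
  exact Normal.conj_mem inferInstance _ (inv_mem hnN) _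

/-- A property of groups that passes to subgroups of iterated extensions of cyclic or finite groups
and, up to finite index, to extensions by cyclic groups holds virtually. -/
theorem IsPolyCyclicOrFinite.exists_finiteIndex {P R : (G : Type u) → [Group G] → Prop}
    (hP : ∀ {G H : Type u} [Group G] [Group H] (f : H →* G), Function.Injective f → P G → P H)
    (hR : ∀ {G H : Type u} [Group G] [Group H] (f : H →* G), Function.Injective f → R G → R H)
    (hP₁ : ∀ (G : Type u) [Group G] [Subsingleton G], P G)
    (hext : ∀ {G : Type u} [Group G], IsPolyCyclicOrFinite G → R G → ∀ (N : Subgroup G) [N.Normal],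
      P N → ∀ t : G, ∃ m : ℕ, 0 < m ∧ P ↥(N ⊔ Subgroup.zpowers (t ^ m)))
    {G : Type u} [instG : Group G] (h : IsPolyCyclicOrFinite G) (hG : R G) :
    ∃ K : Subgroup G, K.FiniteIndex ∧ P K := by
  induction h with
  | trivial G => exact ⟨⊤, inferInstance, hP₁ _⟩
  | @ext G Q _ _ f hQ hker ih =>
    obtain ⟨K, hK, hPK⟩ := ih (hR f.ker.subtype f.ker.subtype_injective hG)
    have : Group.FG f.ker := fg hker
    obtain ⟨N, hN, hNf, hNK⟩ := K.exists_characteristic_finiteIndex_le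
    have hPN : P (N.map f.ker.subtype) :=
      hP ((Subgroup.inclusion hNK).comp
        (N.equivMapOfInjective _ f.ker.subtype_injective).symm.toMonoidHom)
        ((Subgroup.inclusion_injective hNK).comp (MulEquiv.injective _)) hPK
    rcases hQ with hQ | hQ
    · obtain ⟨t, ht⟩ := f.exists_zpow_inv_mul_mem_ker
      obtain ⟨m, hm, hPm⟩ := hext (.ext f (.inl hQ) hker) hG (N.map f.ker.subtype) hPN t
      exact ⟨_, Subgroup.finiteIndex_sup_zpowers f ht N hm, hPm⟩
    · refine ⟨_, ⟨?_⟩, hPN⟩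
      have hle : N.map f.ker.subtype ≤ f.ker := Subgroup.map_subtype_le N
      rw [← Subgroup.relIndex_mul_index hle]
      refine mul_ne_zero ?_ Subgroup.FiniteIndex.index_ne_zero
      rw [Subgroup.relIndex, Subgroup.subgroupOf, Subgroup.comap_map_eq_self_of_injective
        f.ker.subtype_injective]
      exact hNf.index_ne_zero

theorem IsPolyCyclic.sup_zpowers {G : Type u} [Group G] {N : Subgroup G} [N.Normal]
    (hN : IsPolyCyclic N) (t : G) : IsPolyCyclic ↥(N ⊔ Subgroup.zpowers t) := by
  let π := QuotientGroup.mk' N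
  have hle : (N ⊔ Subgroup.zpowers t).map π ≤ Subgroup.zpowers (π t) := by
    rw [Subgroup.map_sup, (Subgroup.map_eq_bot_iff N).2 (QuotientGroup.ker_mk' N).ge,
      bot_sup_eq, MonoidHom.map_zpowers]
  refine .ext (Q := Subgroup.zpowers (π t)) ((π.comp (Subgroup.subtype _)).codRestrict _
    fun x ↦ hle ⟨x, x.2, rfl⟩) inferInstance (hN.of_injective
      (((Subgroup.subtype _).comp (Subgroup.subtype _)).codRestrict _ fun x ↦
        (QuotientGroup.eq_one_iff _).1 (congrArg Subtype.val x.2)) fun x y hxy ↦ ?_)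
  have h := congrArg Subtype.val hxy
  exact Subtype.ext (Subtype.ext h)

theorem IsPolyCyclicOrFinite.isVirtuallyPolycyclic {G : Type u} [Group G]
    (h : IsPolyCyclicOrFinite G) : IsVirtuallyPolycyclic G := by
  obtain ⟨K, hK, hPK⟩ := h.exists_finiteIndex (P := fun G _ ↦ IsPolyCyclic G)
    (R := fun _ _ ↦ True) (fun f hf hG ↦ hG.of_injective f hf) (fun _ _ _ ↦ trivial)
    (fun G _ _ ↦ .trivial G) (fun _ _ _ _ hN _ ↦ ⟨1, one_pos, hN.sup_zpowers _⟩) trivial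
  exact ⟨K, hK, hPK.isPolycyclic⟩

theorem Group.IsNilpotent.of_injective {G H : Type*} [Group G] [Group H] (f : H →* G)
    (hf : Function.Injective f) (hG : Group.IsNilpotent G) : Group.IsNilpotent H :=
  (isNilpotent_congr (MonoidHom.ofInjective hf)).2 inferInstance

theorem IsPolyCyclicOrFinite.isVirtuallyNilpotent {G : Type u} [Group G]
    (h : IsPolyCyclicOrFinite G) (hG : HasWordCollisions G) : IsVirtuallyNilpotent G :=
  h.exists_finiteIndex (P := fun G _ ↦ Group.IsNilpotent G)
    (R := fun G _ ↦ HasWordCollisions G) Group.IsNilpotent.of_injective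
    (fun _ hf hG ↦ hG.of_injective hf) (fun _ _ _ ↦ inferInstance)
    (fun h hG _ _ hN t ↦ exists_isNilpotent_sup_zpowers hG (fun A _ ↦ h.subgroup_fg A) hN t) hG

end VirtualProperties

section ElementaryAmenable

/-- The smallest class of groups that contains the trivial groups and is closed under directed
unions and extensions with commutative or finite quotients. -/
inductive ElementaryAmenableByExtension : (G : Type u) → Group G → Prop
  | trivial (G : Type u) [inst : Group G] [Subsingleton G] : ElementaryAmenableByExtension G inst
  | ext {G Q : Type u} [instG : Group G] [instQ : Group Q] (f : G →* Q)
      (hQ : (∀ a b : Q, a * b = b * a) ∨ Finite Q)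
      (hker : ElementaryAmenableByExtension f.ker inferInstance) :
      ElementaryAmenableByExtension G instG
  | union {G : Type u} [instG : Group G] {ι : Type u} (K : ι → Subgroup G)
      (hdir : Directed (· ≤ ·) K) (hK : ∀ g, ∃ i, g ∈ K i)
      (h : ∀ i, ElementaryAmenableByExtension (K i) inferInstance) :
      ElementaryAmenableByExtension G instG

namespace ElementaryAmenableByExtension

theorem of_injective {G : Type u} {instG : Group G}
    (h : ElementaryAmenableByExtension G instG) : ∀ {H : Type u} [instH : Group H] (i : H →* G),
      Function.Injective i → ElementaryAmenableByExtension H instH := by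
  induction h with
  | trivial G =>
    intro H _ i hi
    have := hi.subsingleton
    exact .trivial H
  | ext f hQ hker ih =>
    intro H _ i hi
    exact .ext (f.comp i) hQ (ih (i.subgroupComap f.ker)
      fun x y hxy ↦ Subtype.ext (hi (congrArg Subtype.val hxy)))
  | union K hdir hK h ih =>
    intro H _ i hi
    exact .union (fun j ↦ (K j).comap i) (hdir.mono_comp _ fun _ _ hle ↦ Subgroup.comap_mono hle)
      (fun g ↦ hK (i g)) fun j ↦ ih j (i.subgroupComap (K j))
        fun x y hxy ↦ Subtype.ext (hi (congrArg Subtype.val hxy))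

theorem of_ker {Q : Type u} {instQ : Group Q} (h : ElementaryAmenableByExtension Q instQ) :
    ∀ {G : Type u} [instG : Group G] (f : G →* Q),
      ElementaryAmenableByExtension f.ker inferInstance →
        ElementaryAmenableByExtension G instG := by
  have key {G Q : Type u} [Group G] [Group Q] (f : G →* Q) (K : Subgroup Q)
      (hf : ElementaryAmenableByExtension f.ker inferInstance) :
      ElementaryAmenableByExtension (f.subgroupComap K).ker inferInstance := by
    refine hf.of_injective (((Subgroup.subtype _).comp (Subgroup.subtype _)).codRestrict f.ker
      fun x ↦ congrArg Subtype.val x.2) fun x y hxy ↦ ?_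
    have h := congrArg Subtype.val hxy
    exact Subtype.ext (Subtype.ext h)
  induction h with
  | trivial Q =>
    intro G _ f hf
    exact hf.of_injective ((MonoidHom.id G).codRestrict f.ker fun _ ↦ Subsingleton.elim _ _)
      fun x y hxy ↦ congrArg Subtype.val hxy
  | ext g hR hker ih =>
    intro G _ f hf
    exact .ext (g.comp f) hR (ih (f.subgroupComap g.ker) (key f g.ker hf))
  | union K hdir hK h ih =>
    intro G _ f hf
    exact .union (fun j ↦ (K j).comap f) (hdir.mono_comp _ fun _ _ hle ↦ Subgroup.comap_mono hle)
      (fun g ↦ hK (f g)) fun j ↦ ih j (f.subgroupComap (K j)) (key f (K j) hf)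

theorem of_surjective {G : Type u} {instG : Group G}
    (h : ElementaryAmenableByExtension G instG) : ∀ {H : Type u} [instH : Group H] (f : G →* H),
      Function.Surjective f → ElementaryAmenableByExtension H instH := by
  induction h with
  | trivial G =>
    intro H _ f hf
    have := hf.subsingleton
    exact .trivial H
  | @ext G Q _ _ g hQ hker ih =>
    intro H _ f hf
    have : (g.ker.map f).Normal := g.normal_ker.map f hf
    let φ : G ⧸ g.ker →* H ⧸ g.ker.map f := QuotientGroup.map _ _ f (Subgroup.le_comap_map _ _)
    have hφ : Function.Surjective φ := by
      intro y
      obtain ⟨y, rfl⟩ := QuotientGroup.mk_surjective y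
      obtain ⟨x, rfl⟩ := hf y
      exact ⟨x, rfl⟩
    have hinj := QuotientGroup.kerLift_injective g
    refine .ext (QuotientGroup.mk' (g.ker.map f)) ?_
      ((ih (f.subgroupMap g.ker) (f.subgroupMap_surjective _)).of_injective
        (Subgroup.inclusion (QuotientGroup.ker_mk' _).le) (Subgroup.inclusion_injective _))
    rcases hQ with hQ | hQ
    · refine .inl fun a b ↦ ?_
      obtain ⟨a, rfl⟩ := hφ a
      obtain ⟨b, rfl⟩ := hφ b
      rw [← map_mul, ← map_mul, hinj (a₁ := a * b) (a₂ := b * a) (by simp only [map_mul, hQ])]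
    · have := Finite.of_injective _ hinj
      exact .inr (Finite.of_surjective φ hφ)
  | union K hdir hK h ih =>
    intro H _ f hf
    refine .union (fun j ↦ (K j).map f) (hdir.mono_comp _ fun _ _ hle ↦ Subgroup.map_mono hle)
      (fun y ↦ ?_) fun j ↦ ih j (f.subgroupMap (K j)) (f.subgroupMap_surjective _)
    obtain ⟨x, rfl⟩ := hf y
    exact (hK x).imp fun j hj ↦ ⟨x, hj, rfl⟩

theorem of_comm_or_finite {G : Type u} [Group G] (h : (∀ a b : G, a * b = b * a) ∨ Finite G) :
    ElementaryAmenableByExtension G inferInstance :=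
  have : Subsingleton (MonoidHom.id G).ker := ⟨fun x y ↦ Subtype.ext (x.2.trans y.2.symm)⟩
  .ext (MonoidHom.id G) h (.trivial _)

/-- A finitely generated elementary amenable group has a characteristic subgroup with
polycyclic-by-finite quotient that is either trivial or not finitely generated. -/
theorem exists_characteristic {G : Type u} {instG : Group G}
    (h : ElementaryAmenableByExtension G instG) : ∀ {L : Type u} [Group L] [Group.FG L]
      (i : L →* G), Function.Injective i →
        ∃ (H : Subgroup L) (_ : H.Characteristic),
          IsPolyCyclicOrFinite (L ⧸ H) ∧ (H = ⊥ ∨ ¬ H.FG) := by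
  induction h with
  | trivial G =>
    intro L _ _ i hi
    have := hi.subsingleton
    exact ⟨⊥, inferInstance, .trivial _, .inl rfl⟩
  | @ext G Q _ _ f hQ hker ih =>
    intro L _ _ i hi
    obtain ⟨M, hM, hLM, hMf⟩ : ∃ (M : Subgroup L) (_ : M.Characteristic),
        IsPolyCyclicOrFinite (L ⧸ M) ∧ M ≤ (f.comp i).ker := by
      rcases hQ with hQ | hQ
      · refine ⟨commutator L, inferInstance,
          .of_comm fun a b ↦ mul_comm (G := Abelianization L) a b, ?_⟩
        refine Subgroup.commutator_le.2 fun x _ y _ ↦ ?_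
        rw [MonoidHom.mem_ker, map_commutatorElement, commutatorElement_eq_one_iff_mul_comm, hQ]
      · obtain ⟨M, hM, _, hle⟩ := (f.comp i).ker.exists_characteristic_finiteIndex_le
        exact ⟨M, hM, .of_finite _, hle⟩
    by_cases hfg : M.FG
    · have : Group.FG M := (Group.fg_iff_subgroup_fg M).2 hfg
      obtain ⟨H, hH, hMH, hH'⟩ := ih ((i.comp M.subtype).codRestrict f.ker fun x ↦ hMf x.2)
        fun x y hxy ↦ Subtype.ext (hi (congrArg Subtype.val hxy))
      refine ⟨H.map M.subtype, inferInstance, ?_, ?_⟩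
      · have hle : H.map M.subtype ≤ M := Subgroup.map_subtype_le H
        let ψ : L ⧸ H.map M.subtype →* L ⧸ M := QuotientGroup.map _ _ (MonoidHom.id L) hle
        let θ : M ⧸ H →* L ⧸ H.map M.subtype :=
          QuotientGroup.map _ _ M.subtype (Subgroup.le_comap_map _ _)
        have hθ : Function.Injective θ := by
          refine (injective_iff_map_eq_one θ).2 fun x hx ↦ ?_
          obtain ⟨x, rfl⟩ := QuotientGroup.mk_surjective x
          obtain ⟨y, hy, hyx⟩ := (QuotientGroup.eq_one_iff _).1 hx
          exact (QuotientGroup.eq_one_iff _).2 (M.subtype_injective hyx ▸ hy)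
        have hker : ψ.ker ≤ θ.range := by
          intro x hx
          obtain ⟨x, rfl⟩ := QuotientGroup.mk_surjective x
          exact ⟨((⟨x, (QuotientGroup.eq_one_iff _).1 hx⟩ : M) : M ⧸ H), rfl⟩
        exact hLM.of_ker ψ (hMH.of_injective
          ((MonoidHom.ofInjective hθ).symm.toMonoidHom.comp (Subgroup.inclusion hker))
          ((MonoidHom.ofInjective hθ).symm.injective.comp (Subgroup.inclusion_injective hker)))
      · rcases hH' with rfl | hH'
        · exact .inl (Subgroup.map_bot _)
        · refine .inr fun hfg' ↦ hH' ?_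
          rw [← Group.fg_iff_subgroup_fg] at hfg' ⊢
          exact Group.fg_of_surjective
            (f := (H.equivMapOfInjective _ M.subtype_injective).symm.toMonoidHom)
            (MulEquiv.surjective _)
    · exact ⟨M, hM, hLM, .inr hfg⟩
  | @union G _ ι K hdir hK h ih =>
    intro L _ hL i hi
    classical
    obtain ⟨S, hS⟩ := hL
    have : Nonempty ι := ⟨(hK 1).choose⟩
    obtain ⟨j, hj⟩ := Directed.exists_mem_subset_of_finset_subset_biUnion
      (f := fun j ↦ (K j : Set G)) hdir (s := S.image i) fun x _ ↦ Set.mem_iUnion.2 (hK x)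
    have hle : ∀ x, i x ∈ K j := by
      have : Subgroup.closure (S : Set L) ≤ (K j).comap i :=
        (Subgroup.closure_le _).2 fun x hx ↦ hj (Finset.mem_coe.2 (Finset.mem_image_of_mem i hx))
      exact fun x ↦ this (hS ▸ Subgroup.mem_top x)
    have : Group.FG L := ⟨S, hS⟩
    exact ih j (i.codRestrict (K j) hle) fun x y hxy ↦ hi (congrArg Subtype.val hxy)

end ElementaryAmenableByExtension

theorem ElementaryAmenable.byExtension {G : Type u} {instG : Group G}
    (h : ElementaryAmenable G instG) : ElementaryAmenableByExtension G instG := by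
  induction h with
  | abelian G h => exact .of_comm_or_finite (.inl h)
  | finite G h => exact .of_comm_or_finite (.inr h)
  | subgroup f hf _ ih => exact ih.of_injective f hf
  | quotient f hf _ ih => exact ih.of_surjective f hf
  | extension N _ _ ih₁ ih₂ =>
    exact ih₂.of_ker (QuotientGroup.mk' N) (ih₁.of_injective
      (Subgroup.inclusion (QuotientGroup.ker_mk' N).le) (Subgroup.inclusion_injective _))
  | @directedUnion G _ ι K hdir htop _ ih =>
    rcases isEmpty_or_nonempty ι with hι | hι
    · rw [iSup_of_empty] at htop
      have := subsingleton_of_bot_eq_top htop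
      have : Subsingleton G := Subgroup.subsingleton_iff.1 this
      exact .trivial G
    · exact .union K hdir (fun g ↦ (Subgroup.mem_iSup_of_directed hdir).1
        (htop ▸ Subgroup.mem_top g)) ih

end ElementaryAmenable

section ExponentialGrowth

theorem two_pow_le_growthFn {G : Type*} [Group G] {X : Finset G} {u v : G} (hu : u ∈ X)
    (hv : v ∈ X) (h : ∀ l l' : List Bool, l.length = l'.length →
      (l.map fun b ↦ cond b v u).prod = (l'.map fun b ↦ cond b v u).prod → l = l') (n : ℕ) :
    2 ^ n ≤ growthFn X n := by
  classical
  have hfin : (wordBall X n).Finite := by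
    let Y : Finset G := X ∪ X.image (·⁻¹)
    refine ((List.finite_length_le Y n).image fun l ↦ (l.map Subtype.val).prod).subset ?_
    rintro _ ⟨l, hl, hlX, rfl⟩
    have hlY : ∀ x ∈ l, x ∈ Y := fun x hx ↦ by
      rcases hlX x hx with h | h
      · exact Finset.mem_union_left _ h
      · exact Finset.mem_union_right _ (Finset.mem_image.2 ⟨_, h, inv_inv x⟩)
    exact ⟨l.attachWith _ hlY, by simpa using hl, by simp⟩
  have := hfin.to_subtype
  let F (l : List.Vector Bool n) : wordBall X n := ⟨(l.1.map fun b ↦ cond b v u).prod,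
    l.1.map fun b ↦ cond b v u, by simp [l.2], fun x hx ↦ by
      obtain ⟨b, -, rfl⟩ := List.mem_map.1 hx
      cases b
      · exact .inl hu
      · exact .inl hv, rfl⟩
  have hF : Function.Injective F := fun l l' hll ↦
    Subtype.ext (h _ _ (l.2.trans l'.2.symm) (congrArg Subtype.val hll))
  have := Nat.card_le_card_of_injective F hF
  rwa [Nat.card_eq_fintype_card, card_vector, Fintype.card_bool] at this

theorem hasExponentialGrowth_of_not_hasWordCollisions {G : Type*} [Group G] [hG : Group.FG G]
    (h : ¬ HasWordCollisions G) : HasExponentialGrowth G := by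
  classical
  obtain ⟨S, hS⟩ := hG
  unfold HasWordCollisions at h
  push Not at h
  obtain ⟨u, v, h⟩ := h
  have hle := two_pow_le_growthFn (X := {u, v} ∪ S) (u := u) (v := v) (by simp) (by simp)
    fun l l' hlen hprod ↦ by_contra fun hne ↦ h l l' hne hlen hprod
  refine ⟨{u, v} ∪ S,
    top_le_iff.1 (hS ▸ Subgroup.closure_mono (Finset.coe_subset.2 Finset.subset_union_right)),
    one_lt_two.trans_le (le_ciInf fun n ↦ ?_)⟩
  have hn : (0 : ℝ) < n + 1 := by positivity
  have h2 : ((2 : ℝ) ^ (n + 1)) ^ ((1 : ℝ) / (n + 1)) = 2 := by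
    rw [← Real.rpow_natCast, ← Real.rpow_mul zero_le_two]
    push_cast
    rw [mul_one_div_cancel hn.ne', Real.rpow_one]
  rw [← h2]
  exact Real.rpow_le_rpow (by positivity) (by exact_mod_cast hle (n + 1)) (by positivity)

end ExponentialGrowth

/-- **Lemma 4.3 (Osin).** Let `G` be a finitely generated elementary amenable group which
is not virtually nilpotent. Then there is a characteristic subgroup `H` of `G` such that
`G/H` is virtually polycyclic and either `G/H` has exponential growth or `H` is not
finitely generated. -/
theorem elementaryAmenable_characteristic_dichotomy
    {G : Type u} [inst : Group G] (hfg : Group.FG G)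
    (hEA : ElementaryAmenable G inst) (hnn : ¬ IsVirtuallyNilpotent G) :
    ∃ (H : Subgroup G) (_ : H.Characteristic),
      IsVirtuallyPolycyclic (G ⧸ H) ∧
      (HasExponentialGrowth (G ⧸ H) ∨ ¬ H.FG) := by
  obtain ⟨H, hH, hpoly, hH'⟩ :=
    hEA.byExtension.exists_characteristic (MonoidHom.id G) Function.injective_id
  refine ⟨H, hH, hpoly.isVirtuallyPolycyclic, ?_⟩
  rcases hH' with rfl | hH'
  · refine .inl (hasExponentialGrowth_of_not_hasWordCollisions fun hc ↦ hnn ?_)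
    have hinj : Function.Injective (QuotientGroup.mk' (⊥ : Subgroup G)) := by
      rw [← MonoidHom.ker_eq_bot_iff, QuotientGroup.ker_mk']
    exact IsPolyCyclicOrFinite.isVirtuallyNilpotent (hpoly.of_injective _ hinj)
      (hc.of_injective hinj)
  · exact .inr hH'
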